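/- Over the 3-periodic billiard family, the Feuerbach point X₁₁† of the focus-inversive triangle lies on the circle with center C₁₁† = (c(−1 + ρ²(−a² + b² + δ)/(2a²b²)), 0) and radius R₁₁† = ρ²(−a² + b² + δ)/(2ab²). -/

import Mathlib

noncomputable section

namespace BilliardInv

/-- A point of the plane. -/
abbrev Pt := ℝ × ℝ

/-- Euclidean dot product. -/
def dot (p q : Pt) : ℝ := p.1 * q.1 + p.2 * q.2

/-- Euclidean distance. -/
def dst (p q : Pt) : ℝ := Real.sqrt ((p.1 - q.1) ^ 2 + (p.2 - q.2) ^ 2)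

/-- Membership in the ellipse x²/a² + y²/b² = 1. -/
def onEllipse (a b : ℝ) (p : Pt) : Prop := p.1 ^ 2 / a ^ 2 + p.2 ^ 2 / b ^ 2 = 1

/-- Half the gradient of f(x,y) = x²/a² + y²/b² (an outward normal direction). -/
def nrm (a b : ℝ) (p : Pt) : Pt := (p.1 / a ^ 2, p.2 / b ^ 2)

/-- Unit vector pointing from `v` toward `q`. -/
def udir (v q : Pt) : Pt := (dst v q)⁻¹ • (q - v)

/-- The billiard reflection law at vertex `v` with neighboring vertices `q`, `r`:
the two adjacent sides make equal angles with the ellipse normal at `v`. -/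
def reflectAt (a b : ℝ) (q v r : Pt) : Prop :=
  dot (udir v q) (nrm a b v) = dot (udir v r) (nrm a b v)

/-- A 3-periodic billiard orbit in the ellipse with semi-axes `a > b > 0`:
a nondegenerate triangle inscribed in the ellipse obeying the reflection
law at each vertex. -/
structure Orbit3 (a b : ℝ) : Type where
  P1 : Pt
  P2 : Pt
  P3 : Pt
  h1 : onEllipse a b P1
  h2 : onEllipse a b P2
  h3 : onEllipse a b P3
  d12 : P1 ≠ P2
  d23 : P2 ≠ P3
  d31 : P3 ≠ P1
  r1 : reflectAt a b P3 P1 P2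
  r2 : reflectAt a b P1 P2 P3
  r3 : reflectAt a b P2 P3 P1

/-- Inversion of `p` with respect to the circle of radius `ρ` centered at `f`. -/
def inva (ρ : ℝ) (f p : Pt) : Pt :=
  f + (ρ ^ 2 / ((p.1 - f.1) ^ 2 + (p.2 - f.2) ^ 2)) • (p - f)

/-- Unsigned area of a triangle. -/
def area (A B C : Pt) : ℝ :=
  |(B.1 - A.1) * (C.2 - A.2) - (B.2 - A.2) * (C.1 - A.1)| / 2

/-- The point with barycentric coordinates wA : wB : wC w.r.t. triangle ABC. -/
def bary (wA wB wC : ℝ) (A B C : Pt) : Pt :=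
  (wA + wB + wC)⁻¹ • (wA • A + wB • B + wC • C)

/-- Side length a = |BC|. -/
def sA (A B C : Pt) : ℝ := dst B C
/-- Side length b = |CA|. -/
def sB (A B C : Pt) : ℝ := dst C A
/-- Side length c = |AB|. -/
def sC (A B C : Pt) : ℝ := dst A B

/-- Incenter X(1). -/
def incenter (A B C : Pt) : Pt := bary (sA A B C) (sB A B C) (sC A B C) A B C

/-- Barycenter (centroid) X(2). -/
def centroid (A B C : Pt) : Pt := bary 1 1 1 A B C

/-- Circumcenter X(3), via its barycentric coordinates a²(b²+c²−a²) : · : ·. -/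
def circumcenter (A B C : Pt) : Pt :=
  bary (sA A B C ^ 2 * (sB A B C ^ 2 + sC A B C ^ 2 - sA A B C ^ 2))
       (sB A B C ^ 2 * (sC A B C ^ 2 + sA A B C ^ 2 - sB A B C ^ 2))
       (sC A B C ^ 2 * (sA A B C ^ 2 + sB A B C ^ 2 - sC A B C ^ 2)) A B C

/-- Orthocenter X(4) = A + B + C − 2·(circumcenter). -/
def orthocenter (A B C : Pt) : Pt := A + B + C - (2 : ℝ) • circumcenter A B C

/-- Nine-point center X(5): midpoint of circumcenter and orthocenter. -/
def ninePointCenter (A B C : Pt) : Pt :=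
  ((1 : ℝ) / 2) • (circumcenter A B C + orthocenter A B C)

/-- Gergonne point X(7), barycentrics 1/(b+c−a) : 1/(c+a−b) : 1/(a+b−c). -/
def gergonne (A B C : Pt) : Pt :=
  bary (sB A B C + sC A B C - sA A B C)⁻¹
       (sC A B C + sA A B C - sB A B C)⁻¹
       (sA A B C + sB A B C - sC A B C)⁻¹ A B C

/-- Mittenpunkt X(9), barycentrics a(b+c−a) : b(c+a−b) : c(a+b−c). -/
def mittenpunkt (A B C : Pt) : Pt :=
  bary (sA A B C * (sB A B C + sC A B C - sA A B C))
       (sB A B C * (sC A B C + sA A B C - sB A B C))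
       (sC A B C * (sA A B C + sB A B C - sC A B C)) A B C

/-- Feuerbach point X(11), barycentrics (b+c−a)(b−c)² : · : ·. -/
def feuerbach (A B C : Pt) : Pt :=
  bary ((sB A B C + sC A B C - sA A B C) * (sB A B C - sC A B C) ^ 2)
       ((sC A B C + sA A B C - sB A B C) * (sC A B C - sA A B C) ^ 2)
       ((sA A B C + sB A B C - sC A B C) * (sA A B C - sB A B C) ^ 2) A B C

/-- Triangle center X(100), barycentrics a/(b−c) : b/(c−a) : c/(a−b). -/
def X100 (A B C : Pt) : Pt :=
  bary (sA A B C / (sB A B C - sC A B C))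
       (sB A B C / (sC A B C - sA A B C))
       (sC A B C / (sA A B C - sB A B C)) A B C

/-- Orthogonal projection of `Q` onto the line through `A` and `B`. -/
def projLine (Q A B : Pt) : Pt :=
  A + (dot (Q - A) (B - A) / dot (B - A) (B - A)) • (B - A)

/-- Unsigned area of the pedal triangle of `Q` w.r.t. triangle `A B C`. -/
def pedalArea (Q A B C : Pt) : ℝ :=
  area (projLine Q A B) (projLine Q B C) (projLine Q C A)

end BilliardInv

open BilliardInv Real


lemma closureC (w1 w2 w3 v1 v2 v3 q g : ℂ) (e1 : w1*v1=1) (e2 : w2*v2=1) (e3 : w3*v3=1)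
   (d12 : w1 ≠ w2) (d23 : w2 ≠ w3) (d31 : w3 ≠ w1)
   (h12 : w1*v2+v1*w2 - q*(w1*w2+v1*v2) = 2*g)
   (h23 : w2*v3+v2*w3 - q*(w2*w3+v2*v3) = 2*g)
   (h31 : w3*v1+v3*w1 - q*(w3*w1+v3*v1) = 2*g)
   (cj : w1+w2+w3+q*(w1*w2*w3) = 0 → v1+v2+v3+q*(v1*v2*v3)=0) :
   1+2*g = q^2 := by
  have k12 : w1^2+w2^2-q*w1^2*w2^2-q = 2*g*w1*w2 := by
    linear_combination w1*w2*h12 - (w2^2- q*w2*v2)*e1 - (w1^2 - q)*e2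
  have k23 : w2^2+w3^2-q*w2^2*w3^2-q = 2*g*w2*w3 := by
    linear_combination w2*w3*h23 - (w3^2- q*w3*v3)*e2 - (w2^2 - q)*e3
  have k31 : w3^2+w1^2-q*w3^2*w1^2-q = 2*g*w3*w1 := by
    linear_combination w3*w1*h31 - (w1^2- q*w1*v1)*e3 - (w3^2 - q)*e1
  have m1 : w1+w2+w3+q*(w1*w2*w3) = (1+2*g+q*(w1*w2+w2*w3+w3*w1))*w1 := by
    apply mul_left_cancel₀ (sub_ne_zero.2 d23)
    linear_combination k12 - k31
  have m2 : w1+w2+w3+q*(w1*w2*w3) = (1+2*g+q*(w1*w2+w2*w3+w3*w1))*w2 := by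
    apply mul_left_cancel₀ (sub_ne_zero.2 d31)
    linear_combination k23 - k12
  have n : 1+2*g+q*(w1*w2+w2*w3+w3*w1) = 0 := by
    apply mul_right_cancel₀ (sub_ne_zero.2 d12)
    linear_combination m2 - m1
  have n0 : w1+w2+w3+q*(w1*w2*w3) = 0 := by rw [m1, n, zero_mul]
  have n1 := cj n0
  have n2 : w1*w2+w2*w3+w3*w1 + q = 0 := by
    linear_combination w1*w2*w3*n1 - (w2*w3 +q*w2*w3*v2*v3)*e1 - (w3*w1+q*w3*v3)*e2 - (w1*w2+q)*e3
  linear_combination n - q*n2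

lemma orthoC (z1 z2 z3 v1 v2 v3 h : ℂ) (e1 : z1*v1=1) (e2 : z2*v2=1) (e3 : z3*v3=1)
   (d12 : z1 ≠ z2) (d23 : z2 ≠ z3) (d31 : z3 ≠ z1)
   (h1 : (z1-h)*(v2-v3)+(v1-h)*(z2-z3)=0)
   (h2 : (z2-h)*(v3-v1)+(v2-h)*(z3-z1)=0) :
   z1+z2+z3 = h ∧ v1+v2+v3 = h := by
  have k1 : z1+z2+z3-h = (v1+v2+v3-h)*(z2*z3) := by
    apply mul_left_cancel₀ (sub_ne_zero.2 d23)
    linear_combination -z2*z3*h1 + (z3*z1 - z3*h + z3^2 - z2*z3)*e2 + (-z2*z1 + z2*h + z2*z3 - z2^2)*e3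
  have k2 : z1+z2+z3-h = (v1+v2+v3-h)*(z3*z1) := by
    apply mul_left_cancel₀ (sub_ne_zero.2 d31)
    linear_combination -z3*z1*h2 + (z1*z2 - z1*h + z1^2 - z3*z1)*e3 + (-z3*z2 + z3*h + z3*z1 - z3^2)*e1
  have z30 : z3 ≠ 0 := left_ne_zero_of_mul_eq_one e3
  have k3 : v1+v2+v3-h = 0 := by
    apply mul_right_cancel₀ (mul_ne_zero z30 (sub_ne_zero.2 d12))
    linear_combination k1 - k2
  rw [k3, zero_mul] at k1
  exact ⟨sub_eq_zero.1 k1, sub_eq_zero.1 k3⟩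

lemma feuC (z1 z2 z3 h s : ℂ) (hs : s = z1*z2*z3) (hh : h = z1+z2+z3) (hp : z1*z2+z2*z3+z3*z1 = h*s) :
   z1*((3+h^2)*z1-2*h*(z1^2+1))*(z2-z3)^2*(z2*z3-1)^2*(2*z1+s-h) +
   z2*((3+h^2)*z2-2*h*(z2^2+1))*(z3-z1)^2*(z3*z1-1)^2*(2*z2+s-h) +
   z3*((3+h^2)*z3-2*h*(z3^2+1))*(z1-z2)^2*(z1*z2-1)^2*(2*z3+s-h) = 0 ∧
   z1*((3+h^2)*z1-2*h*(z1^2+1))*(z2-z3)^2*(z2*z3-1)^2*(1+h^2-2*(z1^2+1)-2*h*s) +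
   z2*((3+h^2)*z2-2*h*(z2^2+1))*(z3-z1)^2*(z3*z1-1)^2*(1+h^2-2*(z2^2+1)-2*h*s) +
   z3*((3+h^2)*z3-2*h*(z3^2+1))*(z1-z2)^2*(z1*z2-1)^2*(1+h^2-2*(z3^2+1)-2*h*s) = 0 := by
  obtain ⟨p, hpp⟩ : ∃ p, p = z1*z2+z2*z3+z3*z1 := ⟨_, rfl⟩
  rw [← hpp] at hp
  constructor
  · have := congrArg (fun t => t*((8)*h^1*p^2*s^0 + (8)*h^1*p^1*s^2 + (-8)*h^2*p^1*s^1 + (-2)*h^3*p^1*s^0 + (-18)*h^0*p^1*s^1 + (-8)*h^1*p^1*s^0 + (-2)*h^3*p^0*s^2 + (2)*h^4*p^0*s^1 + (-18)*h^0*p^0*s^3 + (18)*h^1*p^0*s^2 + (2)*h^3*p^0*s^0 + (18)*h^0*p^0*s^1)) (sub_eq_zero.2 hp)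
    simp only [zero_mul] at this
    rw [← this]; subst hs hh hpp; ring
  · have := congrArg (fun t => t*((16)*h^1*p^2*s^1 + (-8)*h^2*p^2*s^0 + (12)*h^0*p^2*s^0 + (-16)*h^2*p^1*s^2 + (4)*h^3*p^1*s^1 + (2)*h^4*p^1*s^0 + (-12)*h^0*p^1*s^2 + (-24)*h^1*p^1*s^1 + (4)*h^2*p^1*s^0 + (-6)*h^0*p^1*s^0 + (-2)*h^5*p^0*s^1 + (36)*h^1*p^0*s^3 + (-26)*h^2*p^0*s^2 + (12)*h^3*p^0*s^1 + (-2)*h^4*p^0*s^0 + (54)*h^0*p^0*s^2 + (-18)*h^1*p^0*s^1 + (2)*h^2*p^0*s^0 + (4)*h^4*p^0*s^2)) (sub_eq_zero.2 hp)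
    simp only [zero_mul] at this
    rw [← this]; subst hs hh hpp; ring

lemma feuC2 (z1 z2 z3 v1 v2 v3 x1 x2 x3 h s : ℂ) (e1 : z1*v1=1) (e2 : z2*v2=1) (e3 : z3*v3=1)
   (f1 : 2*x1=z1+v1) (f2 : 2*x2=z2+v2) (f3 : 2*x3=z3+v3)
   (hs : s = z1*z2*z3) (hh : h = z1+z2+z3) (hv : h = v1+v2+v3) :
   (3+h^2-4*h*x1)*(x2-x3)^2*(2*z1+s-h) + (3+h^2-4*h*x2)*(x3-x1)^2*(2*z2+s-h)
     + (3+h^2-4*h*x3)*(x1-x2)^2*(2*z3+s-h) = 0 ∧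
   (3+h^2-4*h*x1)*(x2-x3)^2*(1+h^2-4*x1*z1-2*h*s) + (3+h^2-4*h*x2)*(x3-x1)^2*(1+h^2-4*x2*z2-2*h*s)
     + (3+h^2-4*h*x3)*(x1-x2)^2*(1+h^2-4*x3*z3-2*h*s) = 0 := by
  have hp : z1*z2+z2*z3+z3*z1 = h*s := by
    rw [hv, hs]; linear_combination -z2*z3*e1 - z3*z1*e2 - z1*z2*e3
  have s0 : s ≠ 0 := by
    rw [hs]
    exact mul_ne_zero (mul_ne_zero (left_ne_zero_of_mul_eq_one e1) (left_ne_zero_of_mul_eq_one e2))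
      (left_ne_zero_of_mul_eq_one e3)
  have aux : ∀ z1 z2 z3 v1 v2 v3 x1 x2 x3 : ℂ, z1*v1=1 → z2*v2=1 → z3*v3=1 → 2*x1=z1+v1 →
      2*x2=z2+v2 → 2*x3=z3+v3 → s = z1*z2*z3 → 4*s^2*((3+h^2-4*h*x1)*(x2-x3)^2) =
      z1*((3+h^2)*z1-2*h*(z1^2+1))*(z2-z3)^2*(z2*z3-1)^2 := by
    intro z1 z2 z3 v1 v2 v3 x1 x2 x3 e1 e2 e3 f1 f2 f3 hs
    have a1 : z2*z3*(2*x2-2*x3) = (z2-z3)*(z2*z3-1) := by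
      rw [f2, f3]; linear_combination z3*e2-z2*e3
    have a2 : z1*(2*x1) = z1^2+1 := by rw [f1]; linear_combination e1
    rw [← a2]
    have a3 : (z2*z3*(2*x2-2*x3))^2 = ((z2-z3)*(z2*z3-1))^2 := by rw [a1]
    rw [hs]
    linear_combination z1*((3+h^2)*z1-2*h*(z1*(2*x1)))*a3
  have b1 := aux z1 z2 z3 v1 v2 v3 x1 x2 x3 e1 e2 e3 f1 f2 f3 hs
  have b2 := aux z2 z3 z1 v2 v3 v1 x2 x3 x1 e2 e3 e1 f2 f3 f1 (by rw [hs]; ring)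
  have b3 := aux z3 z1 z2 v3 v1 v2 x3 x1 x2 e3 e1 e2 f3 f1 f2 (by rw [hs]; ring)
  obtain ⟨c1, c2⟩ := feuC z1 z2 z3 h s hs hh hp
  rw [← b1, ← b2, ← b3] at c1 c2
  have a1 : z1*(2*x1) = z1^2+1 := by rw [f1]; linear_combination e1
  have a2 : z2*(2*x2) = z2^2+1 := by rw [f2]; linear_combination e2
  have a3 : z3*(2*x3) = z3^2+1 := by rw [f3]; linear_combination e3
  rw [← a1, ← a2, ← a3] at c2
  have s4 : 4*s^2 ≠ 0 := by simpa using s0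
  constructor
  · apply mul_left_cancel₀ s4
    linear_combination c1
  · apply mul_left_cancel₀ s4
    linear_combination c2

lemma reim (A B : ℝ) (h : (A:ℂ) + (B:ℂ)*Complex.I = 0) : A = 0 ∧ B = 0 := by
  have h1 := congrArg Complex.re h
  have h2 := congrArg Complex.im h
  simp at h1 h2
  exact ⟨h1, h2⟩

lemma feuR (x1 x2 x3 y1 y2 y3 h : ℝ) (e1 : x1^2+y1^2=1) (e2 : x2^2+y2^2=1) (e3 : x3^2+y3^2=1)
   (hx : x1+x2+x3=h) (hy : y1+y2+y3=0) : ∃ S T : ℝ, S^2+T^2=1 ∧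
   (3+h^2-4*h*x1)*(x2-x3)^2*(2*x1+S-h) + (3+h^2-4*h*x2)*(x3-x1)^2*(2*x2+S-h)
     + (3+h^2-4*h*x3)*(x1-x2)^2*(2*x3+S-h) = 0 ∧
   (3+h^2-4*h*x1)*(x2-x3)^2*(2*y1+T) + (3+h^2-4*h*x2)*(x3-x1)^2*(2*y2+T)
     + (3+h^2-4*h*x3)*(x1-x2)^2*(2*y3+T) = 0 ∧
   (3+h^2-4*h*x1)*(x2-x3)^2*(1+h^2-4*x1*x1-2*h*S) + (3+h^2-4*h*x2)*(x3-x1)^2*(1+h^2-4*x2*x2-2*h*S)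
     + (3+h^2-4*h*x3)*(x1-x2)^2*(1+h^2-4*x3*x3-2*h*S) = 0 ∧
   (3+h^2-4*h*x1)*(x2-x3)^2*(-4*x1*y1-2*h*T) + (3+h^2-4*h*x2)*(x3-x1)^2*(-4*x2*y2-2*h*T)
     + (3+h^2-4*h*x3)*(x1-x2)^2*(-4*x3*y3-2*h*T) = 0 := by
  have II := Complex.I_mul_I
  have u : ∀ x y : ℝ, x^2+y^2=1 → ((x:ℂ)+y*Complex.I)*((x:ℂ)-y*Complex.I)=1 := by
    intro x y e
    have : (x:ℂ)^2+(y:ℂ)^2=1 := by exact_mod_cast e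
    linear_combination this - y^2*II
  have hxc : (x1:ℂ)+x2+x3=h := by exact_mod_cast hx
  have hyc : (y1:ℂ)+y2+y3=0 := by exact_mod_cast hy
  obtain ⟨c1, c2⟩ := feuC2 (x1+y1*Complex.I) (x2+y2*Complex.I) (x3+y3*Complex.I)
    (x1-y1*Complex.I) (x2-y2*Complex.I) (x3-y3*Complex.I) x1 x2 x3 h _
    (u _ _ e1) (u _ _ e2) (u _ _ e3) (by ring) (by ring) (by ring) rfl
    (by linear_combination -hxc - Complex.I*hyc) (by linear_combination -hxc + Complex.I*hyc)
  obtain ⟨S, hS⟩ : ∃ S : ℝ, S = (x1*x2-y1*y2)*x3-(x1*y2+y1*x2)*y3 := ⟨_, rfl⟩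
  obtain ⟨T, hT⟩ : ∃ T : ℝ, T = (x1*x2-y1*y2)*y3+(x1*y2+y1*x2)*x3 := ⟨_, rfl⟩
  have hST : ((x1:ℂ)+y1*Complex.I)*(x2+y2*Complex.I)*(x3+y3*Complex.I) = S + T*Complex.I := by
    rw [hS, hT]; push_cast
    linear_combination (y1*y2*x3 + x1*y2*y3+y1*x2*y3 + y1*y2*y3*Complex.I : ℂ)*II
  rw [hST] at c1 c2
  refine ⟨S, T, ?_, ?_⟩
  · have : S^2+T^2 = (x1^2+y1^2)*(x2^2+y2^2)*(x3^2+y3^2) := by rw [hS, hT]; ring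
    rw [this, e1, e2, e3]; norm_num
  obtain ⟨r1, r2⟩ := reim ((3+h^2-4*h*x1)*(x2-x3)^2*(2*x1+S-h) + (3+h^2-4*h*x2)*(x3-x1)^2*(2*x2+S-h)
     + (3+h^2-4*h*x3)*(x1-x2)^2*(2*x3+S-h)) ((3+h^2-4*h*x1)*(x2-x3)^2*(2*y1+T) + (3+h^2-4*h*x2)*(x3-x1)^2*(2*y2+T)
     + (3+h^2-4*h*x3)*(x1-x2)^2*(2*y3+T)) (by push_cast; linear_combination c1)
  obtain ⟨r3, r4⟩ := reim ((3+h^2-4*h*x1)*(x2-x3)^2*(1+h^2-4*x1*x1-2*h*S) + (3+h^2-4*h*x2)*(x3-x1)^2*(1+h^2-4*x2*x2-2*h*S)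
     + (3+h^2-4*h*x3)*(x1-x2)^2*(1+h^2-4*x3*x3-2*h*S)) ((3+h^2-4*h*x1)*(x2-x3)^2*(-4*x1*y1-2*h*T) + (3+h^2-4*h*x2)*(x3-x1)^2*(-4*x2*y2-2*h*T)
     + (3+h^2-4*h*x3)*(x1-x2)^2*(-4*x3*y3-2*h*T)) (by push_cast; linear_combination c2)
  exact ⟨r1, r2, r3, r4⟩

lemma orthoR (x1 x2 x3 y1 y2 y3 h : ℝ) (e1 : x1^2+y1^2=1) (e2 : x2^2+y2^2=1) (e3 : x3^2+y3^2=1)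
   (d12 : ¬ (x1 = x2 ∧ y1 = y2)) (d23 : ¬ (x2 = x3 ∧ y2 = y3)) (d31 : ¬ (x3 = x1 ∧ y3 = y1))
   (h1 : (x1-h)*(x2-x3)+y1*(y2-y3)=0) (h2 : (x2-h)*(x3-x1)+y2*(y3-y1)=0) :
   x1+x2+x3=h ∧ y1+y2+y3=0 := by
  have II := Complex.I_mul_I
  have u : ∀ x y : ℝ, x^2+y^2=1 → ((x:ℂ)+y*Complex.I)*((x:ℂ)-y*Complex.I)=1 := by
    intro x y e
    have : (x:ℂ)^2+(y:ℂ)^2=1 := by exact_mod_cast e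
    linear_combination this - y^2*II
  have nd : ∀ x y x' y' : ℝ, ¬ (x = x' ∧ y = y') → ((x:ℂ)+y*Complex.I) ≠ ((x':ℂ)+y'*Complex.I) := by
    intro x y x' y' hn he
    obtain ⟨r, s⟩ := reim (x-x') (y-y') (by push_cast; linear_combination he)
    exact hn ⟨sub_eq_zero.1 r, sub_eq_zero.1 s⟩
  have h1c : ((x1:ℂ)-h)*(x2-x3)+y1*(y2-y3)=0 := by exact_mod_cast h1
  have h2c : ((x2:ℂ)-h)*(x3-x1)+y2*(y3-y1)=0 := by exact_mod_cast h2
  obtain ⟨c1, c2⟩ := orthoC (x1+y1*Complex.I) (x2+y2*Complex.I) (x3+y3*Complex.I)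
    (x1-y1*Complex.I) (x2-y2*Complex.I) (x3-y3*Complex.I) h
    (u _ _ e1) (u _ _ e2) (u _ _ e3) (nd _ _ _ _ d12) (nd _ _ _ _ d23) (nd _ _ _ _ d31)
    (by linear_combination 2*h1c - 2*y1*(y2-y3)*II) (by linear_combination 2*h2c - 2*y2*(y3-y1)*II)
  obtain ⟨r, s⟩ := reim (x1+x2+x3-h) (y1+y2+y3) (by push_cast; linear_combination c1)
  exact ⟨sub_eq_zero.1 r, s⟩

lemma closureR (x1 x2 x3 y1 y2 y3 q g : ℝ) (e1 : x1^2+y1^2=1) (e2 : x2^2+y2^2=1) (e3 : x3^2+y3^2=1)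
   (d12 : ¬ (x1 = x2 ∧ y1 = y2)) (d23 : ¬ (x2 = x3 ∧ y2 = y3)) (d31 : ¬ (x3 = x1 ∧ y3 = y1))
   (h12 : (1-q)*(x1*x2)+(1+q)*(y1*y2)=g) (h23 : (1-q)*(x2*x3)+(1+q)*(y2*y3)=g)
   (h31 : (1-q)*(x3*x1)+(1+q)*(y3*y1)=g) : 1+2*g=q^2 := by
  have II := Complex.I_mul_I
  have u : ∀ x y : ℝ, x^2+y^2=1 → ((x:ℂ)+y*Complex.I)*((x:ℂ)-y*Complex.I)=1 := by
    intro x y e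
    have : (x:ℂ)^2+(y:ℂ)^2=1 := by exact_mod_cast e
    linear_combination this - y^2*II
  have nd : ∀ x y x' y' : ℝ, ¬ (x = x' ∧ y = y') → ((x:ℂ)+y*Complex.I) ≠ ((x':ℂ)+y'*Complex.I) := by
    intro x y x' y' hn he
    obtain ⟨r, s⟩ := reim (x-x') (y-y') (by push_cast; linear_combination he)
    exact hn ⟨sub_eq_zero.1 r, sub_eq_zero.1 s⟩
  have cc : ∀ x y x' y' : ℝ, (1-q)*(x*x')+(1+q)*(y*y')=g →
     ((x:ℂ)+y*Complex.I)*(x'-y'*Complex.I)+(x-y*Complex.I)*(x'+y'*Complex.I)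
      - q*((x+y*Complex.I)*(x'+y'*Complex.I)+(x-y*Complex.I)*(x'-y'*Complex.I)) = 2*g := by
    intro x y x' y' hh
    have : (1-(q:ℂ))*(x*x')+(1+q)*(y*y')=g := by exact_mod_cast hh
    linear_combination 2*this - 2*(1+q)*y*y'*II
  have := closureC (x1+y1*Complex.I) (x2+y2*Complex.I) (x3+y3*Complex.I)
    (x1-y1*Complex.I) (x2-y2*Complex.I) (x3-y3*Complex.I) q g
    (u _ _ e1) (u _ _ e2) (u _ _ e3) (nd _ _ _ _ d12) (nd _ _ _ _ d23) (nd _ _ _ _ d31)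
    (cc _ _ _ _ h12) (cc _ _ _ _ h23) (cc _ _ _ _ h31) (by
      intro hh
      have := congrArg (starRingEnd ℂ) hh
      simp only [map_add, map_mul, Complex.conj_ofReal, Complex.conj_I, map_zero] at this
      linear_combination this)
  exact_mod_cast this

lemma facPos (h x y : ℝ) (h0 : 0 < h) (h1 : h < 1) (hxy : x^2+y^2=1) : 0 < 3+h^2-4*h*x := by
  have hx : x ≤ 1 := by nlinarith [sq_nonneg y]
  have a1 : 0 < (1-h)*(3-h) := mul_pos (by linarith) (by linarith)
  have a2 : 0 ≤ 4*h*(1-x) := mul_nonneg (by linarith) (by linarith)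
  linarith

lemma sideLen (f k e h lam x1 x2 x3 y1 y2 y3 : ℝ) (hk : 0 < k) (hlam : 0 < lam)
   (e1 : x1^2+y1^2=1) (e2 : x2^2+y2^2=1) (e3 : x3^2+y3^2=1)
   (hx : x1+x2+x3=h) (hy : y1+y2+y3=0)
   (l1 : 2*h*lam^2 = (1-e*h/2)*e) (l2 : lam^2*(3-h^2) = (1-e*h/2)^2+e^2/4) :
   dst (f + k*((1-e*x2)*x2), k*((1-e*x2)*y2)) (f + k*((1-e*x3)*x3), k*((1-e*x3)*y3)) =
     k*lam*(3-h^2+2*h*x1) := by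
  have g : (x2-x3)^2+(y2-y3)^2 = 3-h^2+2*h*x1 := by
    have hx' : h - x1 = x2 + x3 := by linarith
    have hy' : -y1 = y2+y3 := by linarith
    have : (h-x1)^2+(-y1)^2 = (x2+x3)^2+(y2+y3)^2 := by rw [hx', hy']
    linear_combination 2*e2+2*e3-e1 + this
  have q1 : (1-e*x2)*x2-(1-e*x3)*x3 = (x2-x3)*(1-e/2*(h-x1)) - (y2-y3)*(-e/2*(-y1)) := by
    have hx' : h - x1 = x2 + x3 := by linarith
    have hy' : -y1 = y2+y3 := by linarith
    rw [hx', hy']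
    linear_combination -e/2*e2 + e/2*e3
  have q2 : (1-e*x2)*y2-(1-e*x3)*y3 = (y2-y3)*(1-e/2*(h-x1)) + (x2-x3)*(-e/2*(-y1)) := by
    have hx' : h - x1 = x2 + x3 := by linarith
    have hy' : -y1 = y2+y3 := by linarith
    rw [hx', hy']
    ring
  have q3 : (1-e/2*(h-x1))^2 + (-e/2*(-y1))^2 = lam^2*(3-h^2+2*h*x1) := by
    linear_combination e^2/4*e1 - l2 - x1*l1
  have pos : 0 ≤ 3-h^2+2*h*x1 := by rw [← g]; positivity
  unfold dst
  have : ((f + k*((1-e*x2)*x2), k*((1-e*x2)*y2)).1 - (f + k*((1-e*x3)*x3), k*((1-e*x3)*y3)).1)^2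
     + ((f + k*((1-e*x2)*x2), k*((1-e*x2)*y2)).2 - (f + k*((1-e*x3)*x3), k*((1-e*x3)*y3)).2)^2
     = (k*lam*(3-h^2+2*h*x1))^2 := by
    have e0 : ((f + k*((1-e*x2)*x2), k*((1-e*x2)*y2)).1 - (f + k*((1-e*x3)*x3), k*((1-e*x3)*y3)).1)^2
     + ((f + k*((1-e*x2)*x2), k*((1-e*x2)*y2)).2 - (f + k*((1-e*x3)*x3), k*((1-e*x3)*y3)).2)^2
      = k^2*(((1-e*x2)*x2-(1-e*x3)*x3)^2 + ((1-e*x2)*y2-(1-e*x3)*y3)^2) := by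
      simp only
      ring
    rw [e0, q1, q2]
    linear_combination k^2*((x2-x3)^2+(y2-y3)^2)*q3 + k^2*lam^2*(3-h^2+2*h*x1)*g
  rw [this]
  apply Real.sqrt_sq
  positivity

lemma core (f k e h lam x1 x2 x3 y1 y2 y3 : ℝ) (hk : 0 < k) (hlam : 0 < lam)
   (h0 : 0 < h) (h1 : h < 1) (heh : e*h < 1)
   (e1 : x1^2+y1^2=1) (e2 : x2^2+y2^2=1) (e3 : x3^2+y3^2=1)
   (d12 : ¬ (x1 = x2 ∧ y1 = y2)) (d23 : ¬ (x2 = x3 ∧ y2 = y3)) (d31 : ¬ (x3 = x1 ∧ y3 = y1))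
   (hx : x1+x2+x3=h) (hy : y1+y2+y3=0) (he : e*h^2-2*(1+e^2)*h+3*e=0)
   (l1 : 2*h*lam^2 = (1-e*h/2)*e) (l2 : lam^2*(3-h^2) = (1-e*h/2)^2+e^2/4) :
   dst (feuerbach (f + k*((1-e*x1)*x1), k*((1-e*x1)*y1)) (f + k*((1-e*x2)*x2), k*((1-e*x2)*y2))
     (f + k*((1-e*x3)*x3), k*((1-e*x3)*y3))) (f + k*(e*((1-e*h)/2)), 0) = k*((1-e*h)/2) := by
  have sa := sideLen f k e h lam x1 x2 x3 y1 y2 y3 hk hlam e1 e2 e3 hx hy l1 l2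
  have sb := sideLen f k e h lam x2 x3 x1 y2 y3 y1 hk hlam e2 e3 e1 (by linarith) (by linarith) l1 l2
  have sc := sideLen f k e h lam x3 x1 x2 y3 y1 y2 hk hlam e3 e1 e2 (by linarith) (by linarith) l1 l2
  obtain ⟨S, T, hST, r1, r2, r3, r4⟩ := feuR x1 x2 x3 y1 y2 y3 h e1 e2 e3 hx hy
  obtain ⟨w1, hw1⟩ : ∃ w, w = (3+h^2-4*h*x1)*(x2-x3)^2 := ⟨_, rfl⟩
  obtain ⟨w2, hw2⟩ : ∃ w, w = (3+h^2-4*h*x2)*(x3-x1)^2 := ⟨_, rfl⟩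
  obtain ⟨w3, hw3⟩ : ∃ w, w = (3+h^2-4*h*x3)*(x1-x2)^2 := ⟨_, rfl⟩
  rw [← hw1, ← hw2, ← hw3] at r1 r2 r3 r4
  have p1 := facPos h x1 y1 h0 h1 e1
  have p2 := facPos h x2 y2 h0 h1 e2
  have p3 := facPos h x3 y3 h0 h1 e3
  have wpos : w1+w2+w3 ≠ 0 := by
    intro hw
    have n1 : 0 ≤ w1 := by rw [hw1]; positivity
    have n2 : 0 ≤ w2 := by rw [hw2]; positivity
    have n3 : 0 ≤ w3 := by rw [hw3]; positivity
    have z1 : w1 = 0 := by linarith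
    have z3 : w3 = 0 := by linarith
    rw [hw1] at z1; rw [hw3] at z3
    have g23 : x2 = x3 := by
      rcases mul_eq_zero.1 z1 with h | h
      · linarith
      · exact sub_eq_zero.1 (pow_eq_zero_iff (two_ne_zero) |>.1 h)
    have g12 : x1 = x2 := by
      rcases mul_eq_zero.1 z3 with h | h
      · linarith
      · exact sub_eq_zero.1 (pow_eq_zero_iff (two_ne_zero) |>.1 h)
    have y12 : y1 ≠ y2 := fun hh => d12 ⟨g12, hh⟩
    have y23 : y2 ≠ y3 := fun hh => d23 ⟨g23, hh⟩
    have y31 : y3 ≠ y1 := fun hh => d31 ⟨by rw [g12, g23], hh⟩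
    have a1 : y1 + y2 = 0 := by
      apply mul_left_cancel₀ (sub_ne_zero.2 y12)
      rw [g12] at e1; linear_combination e1 - e2
    have a2 : y2 + y3 = 0 := by
      apply mul_left_cancel₀ (sub_ne_zero.2 y23)
      rw [g23] at e2; linear_combination e2 - e3
    exact y31 (by linarith)
  have fe : feuerbach (f + k*((1-e*x1)*x1), k*((1-e*x1)*y1)) (f + k*((1-e*x2)*x2), k*((1-e*x2)*y2))
     (f + k*((1-e*x3)*x3), k*((1-e*x3)*y3)) =
     (f + k*(e*((1-e*h)/2) - (1-e*h)/2*S), -(k*((1-e*h)/2)*T)) := by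
    unfold feuerbach sA sB sC
    rw [sa, sb, sc]
    have m0 : 4*h^2*(k*lam)^3 ≠ 0 := by positivity
    have t1 : (k*lam*(3-h^2+2*h*x2) + k*lam*(3-h^2+2*h*x3) - k*lam*(3-h^2+2*h*x1)) *
        (k*lam*(3-h^2+2*h*x2) - k*lam*(3-h^2+2*h*x3))^2 = 4*h^2*(k*lam)^3*w1 := by
      rw [hw1]
      have : x2 + x3 = h - x1 := by linarith
      linear_combination (k*lam)^3*4*h^2*(x2-x3)^2*(2*h)*this
    have t2 : (k*lam*(3-h^2+2*h*x3) + k*lam*(3-h^2+2*h*x1) - k*lam*(3-h^2+2*h*x2)) *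
        (k*lam*(3-h^2+2*h*x3) - k*lam*(3-h^2+2*h*x1))^2 = 4*h^2*(k*lam)^3*w2 := by
      rw [hw2]
      have : x3 + x1 = h - x2 := by linarith
      linear_combination (k*lam)^3*4*h^2*(x3-x1)^2*(2*h)*this
    have t3 : (k*lam*(3-h^2+2*h*x1) + k*lam*(3-h^2+2*h*x2) - k*lam*(3-h^2+2*h*x3)) *
        (k*lam*(3-h^2+2*h*x1) - k*lam*(3-h^2+2*h*x2))^2 = 4*h^2*(k*lam)^3*w3 := by
      rw [hw3]
      have : x1 + x2 = h - x3 := by linarith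
      linear_combination (k*lam)^3*4*h^2*(x1-x2)^2*(2*h)*this
    rw [t1, t2, t3]
    generalize 4*h^2*(k*lam)^3 = m at m0
    have mw : m*w1+m*w2+m*w3 ≠ 0 := by
      rw [← mul_add, ← mul_add]; exact mul_ne_zero m0 wpos
    unfold bary
    apply Prod.ext
    · simp only [Prod.smul_fst, Prod.fst_add, smul_eq_mul]
      rw [inv_mul_eq_iff_eq_mul₀ mw]
      linear_combination m*k*(r1/2 + e/4*r3) - m*k*(w1+w2+w3)/4*he
    · simp only [Prod.smul_snd, Prod.snd_add, smul_eq_mul]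
      rw [inv_mul_eq_iff_eq_mul₀ mw]
      linear_combination m*k*(r2/2 + e/4*r4)
  rw [fe]
  unfold dst
  have : ((f + k*(e*((1-e*h)/2) - (1-e*h)/2*S), -(k*((1-e*h)/2)*T)).1 - (f + k*(e*((1-e*h)/2)), (0:ℝ)).1)^2
     + ((f + k*(e*((1-e*h)/2) - (1-e*h)/2*S), -(k*((1-e*h)/2)*T)).2 - (f + k*(e*((1-e*h)/2)), (0:ℝ)).2)^2
     = (k*((1-e*h)/2))^2 := by
    simp only
    linear_combination (k*((1-e*h)/2))^2*hST
  rw [this]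
  apply Real.sqrt_sq
  have : 0 < 1 - e*h := by linarith
  positivity

lemma dstSq (a b X Y X' Y' : ℝ) (e : X^2+Y^2=1) (e' : X'^2+Y'^2=1) :
   (dst (a*X, b*Y) (a*X', b*Y'))^2 =
    (1-X*X'-Y*Y')*(a^2+b^2-(a^2-b^2)*(X*X'-Y*Y')) := by
  unfold dst
  rw [Real.sq_sqrt (by positivity)]
  have k1 : (X-X')^2 = (1-X*X'-Y*Y')*(1-X*X'+Y*Y') := by
    linear_combination e + (-1+Y'^2)*e + (1-X^2)*e'
  have k2 : (Y-Y')^2 = (1-X*X'-Y*Y')*(1+X*X'-Y*Y') := by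
    linear_combination e + (-1+X'^2)*e + (1-Y^2)*e'
  linear_combination a^2*k1 + b^2*k2

lemma gPos (X Y X' Y' : ℝ) (e : X^2+Y^2=1) (e' : X'^2+Y'^2=1) (d : ¬ (X = X' ∧ Y = Y')) :
   0 < 1-X*X'-Y*Y' := by
  have k : 2*(1-X*X'-Y*Y') = (X-X')^2+(Y-Y')^2 := by linear_combination -e-e'
  by_contra hn
  have s1 := sq_nonneg (X-X')
  have s2 := sq_nonneg (Y-Y')
  have z1 : (X-X')^2 = 0 := by linarith
  have z2 : (Y-Y')^2 = 0 := by linarith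
  exact d ⟨sub_eq_zero.1 (pow_eq_zero_iff two_ne_zero |>.1 z1),
    sub_eq_zero.1 (pow_eq_zero_iff two_ne_zero |>.1 z2)⟩

lemma mPos (a b X Y X' Y' : ℝ) (ha : 0 < a) (hb : 0 < b) (e : X^2+Y^2=1) (e' : X'^2+Y'^2=1) 
    (d : ¬ (X = X' ∧ Y = Y')) : 0 < a^2+b^2-(a^2-b^2)*(X*X'-Y*Y') := by
  have g := gPos X Y X' Y' e e' d
  have k := dstSq a b X Y X' Y' e e'
  have : 0 < dst (a*X, b*Y) (a*X', b*Y') := by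
    unfold dst
    apply Real.sqrt_pos.2
    by_contra hn
    have s1 := sq_nonneg (a*X-a*X')
    have s2 := sq_nonneg (b*Y-b*Y')
    simp only at hn
    have z1 : (a*X-a*X')^2 = 0 := by linarith
    have z2 : (b*Y-b*Y')^2 = 0 := by linarith
    exact d ⟨mul_left_cancel₀ ha.ne' (sub_eq_zero.1 (pow_eq_zero_iff two_ne_zero |>.1 z1)),
      mul_left_cancel₀ hb.ne' (sub_eq_zero.1 (pow_eq_zero_iff two_ne_zero |>.1 z2))⟩
  have : 0 < (1-X*X'-Y*Y')*(a^2+b^2-(a^2-b^2)*(X*X'-Y*Y')) := by rw [← k]; positivity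
  exact (mul_pos_iff_of_pos_left g).1 this

lemma reflectEq (a b X Y X1 Y1 X2 Y2 : ℝ) (ha : 0 < a) (hb : 0 < b)
   (e : X^2+Y^2=1) (e1 : X1^2+Y1^2=1) (e2 : X2^2+Y2^2=1)
   (d1 : ¬ (X = X1 ∧ Y = Y1)) (d2 : ¬ (X = X2 ∧ Y = Y2))
   (hr : reflectAt a b (a*X1, b*Y1) (a*X, b*Y) (a*X2, b*Y2)) :
   (1-X*X1-Y*Y1)*(a^2+b^2-(a^2-b^2)*(X*X2-Y*Y2)) =
   (1-X*X2-Y*Y2)*(a^2+b^2-(a^2-b^2)*(X*X1-Y*Y1)) := by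
  have g1 := gPos X Y X1 Y1 e e1 d1
  have g2 := gPos X Y X2 Y2 e e2 d2
  have m1 := mPos a b X Y X1 Y1 ha hb e e1 d1
  have m2 := mPos a b X Y X2 Y2 ha hb e e2 d2
  have k1 := dstSq a b X Y X1 Y1 e e1
  have k2 := dstSq a b X Y X2 Y2 e e2
  unfold reflectAt udir nrm dot at hr
  simp only [Prod.smul_fst, Prod.smul_snd, Prod.fst_sub, Prod.snd_sub, smul_eq_mul] at hr
  have l1 : dst (a*X, b*Y) (a*X1, b*Y1) ≠ 0 := by
    intro h; rw [h] at k1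
    have := mul_pos g1 m1
    simp at k1; rcases k1 with k | k <;> linarith
  have l2 : dst (a*X, b*Y) (a*X2, b*Y2) ≠ 0 := by
    intro h; rw [h] at k2
    have := mul_pos g2 m2
    simp at k2; rcases k2 with k | k <;> linarith
  generalize dst (a*X, b*Y) (a*X1, b*Y1) = L1 at *
  generalize dst (a*X, b*Y) (a*X2, b*Y2) = L2 at *
  have hr2 : (1-X*X1-Y*Y1)*L2 = (1-X*X2-Y*Y2)*L1 := by
    have := ha.ne'
    have := hb.ne'
    field_simp at hr
    have hr' : L2*(X1*X+Y1*Y-(X^2+Y^2)) = L1*(X2*X+Y2*Y-(X^2+Y^2)) := by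
      linear_combination hr
    rw [e] at hr'
    linear_combination -hr'
  have hr3 : ((1-X*X1-Y*Y1)*L2)^2 = ((1-X*X2-Y*Y2)*L1)^2 := by rw [hr2]
  rw [mul_pow, mul_pow, k1, k2] at hr3
  apply mul_left_cancel₀ (mul_pos g1 g2).ne'
  linear_combination hr3

lemma orthoPair (e q g h bb X1 Y1 X2 Y2 X3 Y3 : ℝ) (hq : 0 < q) (hbb : bb^2 = 1-e^2)
   (p1 : 1+e*X1 ≠ 0) (p2 : 1+e*X2 ≠ 0) (p3 : 1+e*X3 ≠ 0)
   (r12 : (1-q)*(X1*X2)+(1+q)*(Y1*Y2)=g) (r31 : (1-q)*(X3*X1)+(1+q)*(Y3*Y1)=g)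
   (hg : 1+2*g=q^2) (hh : h = e*(3-q)/2) (heh : (1+q)*(e*h)=2*q) :
   ((X1+e)/(1+e*X1)-h)*((X2+e)/(1+e*X2)-(X3+e)/(1+e*X3)) +
     bb*Y1/(1+e*X1)*(bb*Y2/(1+e*X2)-bb*Y3/(1+e*X3)) = 0 := by
  have q1 : 1+q ≠ 0 := by positivity
  have G : (X1*(1-e*h)+e-h)*(X2-X3)+Y1*Y2*(1+e*X3)-Y1*Y3*(1+e*X2) = 0 := by
    apply mul_left_cancel₀ q1
    linear_combination (1+e*X3)*r12 - (1+e*X2)*r31 - X1*(X2-X3)*heh - (1+q)*(X2-X3)*hh - e/2*(X2-X3)*hg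
  have A1 : (X1+e)/(1+e*X1)-h = (X1+e-h*(1+e*X1))/(1+e*X1) := by
    rw [sub_div, mul_div_cancel_right₀ _ p1]
  have A2 : (X2+e)/(1+e*X2)-(X3+e)/(1+e*X3) = (1-e^2)*(X2-X3)/((1+e*X2)*(1+e*X3)) := by
    rw [div_sub_div _ _ p2 p3]; congr 1; ring
  have A3 : bb*Y2/(1+e*X2)-bb*Y3/(1+e*X3) = bb*(Y2*(1+e*X3)-Y3*(1+e*X2))/((1+e*X2)*(1+e*X3)) := by
    rw [div_sub_div _ _ p2 p3]; congr 1; ring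
  rw [A1, A2, A3, div_mul_div_comm, div_mul_div_comm, ← add_div, div_eq_zero_iff]
  left
  linear_combination (1-e^2)*G + Y1*(Y2*(1+e*X3)-Y3*(1+e*X2))*hbb

lemma dPos (e X Y : ℝ) (e0 : 0 < e) (e1 : e < 1) (hXY : X^2+Y^2=1) : 0 < 1+e*X := by
  have : -1 ≤ X := by nlinarith [sq_nonneg Y]
  nlinarith

lemma ltOne (h : ℝ) (hh : 0 < 1 - h^2) : h < 1 := by nlinarith

lemma cvt (k e X U : ℝ) (hp : 0 < 1+e*X) :
    k*((1-e*((X+e)/(1+e*X)))*(U/(1+e*X))) = k*(1-e^2)*(U/(1+e*X)^2) := by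
  have := hp.ne'
  have A : 1-e*((X+e)/(1+e*X)) = (1-e^2)/(1+e*X) := by
    field_simp
    ring
  rw [A, div_mul_div_comm, ← sq]; ring

set_option maxHeartbeats 1000000 in
lemma mid (f k e q g bb X1 Y1 X2 Y2 X3 Y3 : ℝ) (hk : 0 < k) (he0 : 0 < e) (he1 : e < 1) (hq : 0 < q)
   (hbb0 : 0 < bb) (hbb : bb^2 = 1-e^2)
   (e1 : X1^2+Y1^2=1) (e2 : X2^2+Y2^2=1) (e3 : X3^2+Y3^2=1)
   (d12 : ¬ (X1 = X2 ∧ Y1 = Y2)) (d23 : ¬ (X2 = X3 ∧ Y2 = Y3)) (d31 : ¬ (X3 = X1 ∧ Y3 = Y1))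
   (r12 : (1-q)*(X1*X2)+(1+q)*(Y1*Y2)=g) (r23 : (1-q)*(X2*X3)+(1+q)*(Y2*Y3)=g)
   (r31 : (1-q)*(X3*X1)+(1+q)*(Y3*Y1)=g) (hg : 1+2*g=q^2)
   (heq : e^2*((3-q)*(1+q)) = 4*q) :
   ∃ h : ℝ, e*h < 1 ∧ e*h^2-2*(1+e^2)*h+3*e=0 ∧
   dst (feuerbach (f + k*(1-e^2)*((X1+e)/(1+e*X1)^2), k*(1-e^2)*(bb*Y1/(1+e*X1)^2))
    (f + k*(1-e^2)*((X2+e)/(1+e*X2)^2), k*(1-e^2)*(bb*Y2/(1+e*X2)^2))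
    (f + k*(1-e^2)*((X3+e)/(1+e*X3)^2), k*(1-e^2)*(bb*Y3/(1+e*X3)^2)))
    (f + k*(e*((1-e*h)/2)), 0) = k*((1-e*h)/2) := by
  have hE : 0 < 1-e^2 := by rw [← hbb]; positivity
  have hpr : 0 < (3-q)*(1+q) := by
    by_contra hn
    have : e^2*((3-q)*(1+q)) ≤ 0 := mul_nonpos_of_nonneg_of_nonpos (sq_nonneg e) (not_lt.1 hn)
    linarith
  have hp : 0 < 3-q := (mul_pos_iff_of_pos_right (by linarith)).1 hpr
  have hq1 : q < 1 := by
    have h1 : 0 < (3-q)*(1+q)*(1-e^2) := mul_pos hpr hE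
    have h2 : 0 < (3+q)*(1-q) := by linarith
    have h3 : 0 < 1-q := (mul_pos_iff_of_pos_left (by linarith)).1 h2
    linarith
  obtain ⟨h, hh⟩ : ∃ h : ℝ, h = e*(3-q)/2 := ⟨_, rfl⟩
  have q1 : (1+q) ≠ 0 := by positivity
  have heh : (1+q)*(e*h)=2*q := by rw [hh]; linear_combination heq/2
  have h0 : 0 < h := by rw [hh]; positivity
  have hh2 : (1+q)*h^2 = q*(3-q) := by rw [hh]; linear_combination (3-q)/4*heq
  have h1 : h < 1 := by
    have : 0 < (1+q)*(1-h^2) := by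
      have : 0 < (1-q)^2 := by have : 0 < 1-q := by linarith
                               positivity
      linarith
    exact ltOne h ((mul_pos_iff_of_pos_left (by linarith)).1 this)
  have heh1 : e*h < 1 := by
    by_contra hn
    have : (1+q)*1 ≤ (1+q)*(e*h) := mul_le_mul_of_nonneg_left (not_lt.1 hn) (by linarith)
    linarith
  have he : e*h^2-2*(1+e^2)*h+3*e=0 := by
    apply mul_left_cancel₀ q1
    rw [hh]
    linear_combination (e*(3-q)/4 - e)*heq
  have p1 := dPos e X1 Y1 he0 he1 e1
  have p2 := dPos e X2 Y2 he0 he1 e2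
  have p3 := dPos e X3 Y3 he0 he1 e3
  have un : ∀ X Y : ℝ, 0 < 1+e*X → X^2+Y^2=1 → ((X+e)/(1+e*X))^2+(bb*Y/(1+e*X))^2=1 := by
    intro X Y hp hXY
    rw [div_pow, div_pow, ← add_div, div_eq_one_iff_eq (by positivity)]
    linear_combination (1-e^2)*hXY + Y^2*hbb
  have ds : ∀ X Y X' Y' : ℝ, 0 < 1+e*X → 0 < 1+e*X' → ¬ (X = X' ∧ Y = Y') →
     ¬ ((X+e)/(1+e*X) = (X'+e)/(1+e*X') ∧ bb*Y/(1+e*X) = bb*Y'/(1+e*X')) := by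
    rintro X Y X' Y' hp hp' hn ⟨u1, u2⟩
    rw [div_eq_div_iff hp.ne' hp'.ne'] at u1 u2
    have v1 : X = X' := by
      apply mul_left_cancel₀ hE.ne'
      linear_combination u1
    subst v1
    exact hn ⟨rfl, mul_left_cancel₀ hbb0.ne' (mul_right_cancel₀ hp.ne' u2)⟩
  obtain ⟨lam, hlam0, hlam⟩ : ∃ lam : ℝ, 0 < lam ∧ lam^2*((3-q)*(1+q)) = 1 := by
    refine ⟨(Real.sqrt ((3-q)*(1+q)))⁻¹, by positivity, ?_⟩
    rw [inv_pow, Real.sq_sqrt hpr.le]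
    exact inv_mul_cancel₀ hpr.ne'
  have l1 : 2*h*lam^2 = (1-e*h/2)*e := by
    apply mul_left_cancel₀ q1
    rw [hh]
    linear_combination e*hlam + e/4*heq
  have l2 : lam^2*(3-h^2) = (1-e*h/2)^2+e^2/4 := by
    have a1 : (1+q)*(1-e*h/2) = 1 := by linear_combination -heh/2
    have a2 : (1+q)^2*(1-e*h/2)^2 = 1 := by rw [← mul_pow, a1]; norm_num
    apply mul_left_cancel₀ (mul_pos hp (pow_pos (by linarith : 0 < 1+q) 2)).ne'
    linear_combination (1+q)*(3-h^2)*hlam - (3-q)*a2 - (1+q)/4*heq - hh2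
  have c := orthoR _ _ _ _ _ _ h (un X1 Y1 p1 e1) (un X2 Y2 p2 e2) (un X3 Y3 p3 e3)
    (ds _ _ _ _ p1 p2 d12) (ds _ _ _ _ p2 p3 d23) (ds _ _ _ _ p3 p1 d31)
    (orthoPair e q g h bb X1 Y1 X2 Y2 X3 Y3 hq hbb p1.ne' p2.ne' p3.ne' r12 r31 hg hh heh)
    (orthoPair e q g h bb X2 Y2 X3 Y3 X1 Y1 hq hbb p2.ne' p3.ne' p1.ne' r23 r12 hg hh heh)
  have fin := core f k e h lam _ _ _ _ _ _ hk hlam0 h0 h1 heh1 (un X1 Y1 p1 e1) (un X2 Y2 p2 e2) (un X3 Y3 p3 e3)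
    (ds _ _ _ _ p1 p2 d12) (ds _ _ _ _ p2 p3 d23) (ds _ _ _ _ p3 p1 d31) c.1 c.2 he l1 l2
  refine ⟨h, heh1, he, ?_⟩
  rw [cvt k e X1 _ p1, cvt k e X1 _ p1, cvt k e X2 _ p2, cvt k e X2 _ p2, cvt k e X3 _ p3, cvt k e X3 _ p3] at fin
  exact fin

/-- over the 3-periodic billiard family, the Feuerbach point X(11) of the
focus-inversive triangle lies on the stated circle. -/
theorem focus_inversive_feuerbach_circle (a b ρ : ℝ) (hab : a > b) (hb : b > 0)
    (hρ : ρ > 0) (T : Orbit3 a b) :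
    let c : ℝ := Real.sqrt (a ^ 2 - b ^ 2)
    let δ : ℝ := Real.sqrt (a ^ 4 - a ^ 2 * b ^ 2 + b ^ 4)
    let f1 : Pt := (-c, 0)
    let Ctr : Pt := (c * (-1 + ρ ^ 2 * (-a ^ 2 + b ^ 2 + δ) / (2 * a ^ 2 * b ^ 2)), 0)
    dst (feuerbach (inva ρ f1 T.P1) (inva ρ f1 T.P2) (inva ρ f1 T.P3)) Ctr =
      ρ ^ 2 * (-a ^ 2 + b ^ 2 + δ) / (2 * a * b ^ 2) := by
  intro c δ f1 Ctr
  have ha : 0 < a := by linarith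
  have hab2 : 0 < a^2-b^2 := by nlinarith
  have hc0 : 0 < c := Real.sqrt_pos.2 hab2
  have hc2 : c^2 = a^2-b^2 := Real.sq_sqrt hab2.le
  obtain ⟨⟨px1, py1⟩, ⟨px2, py2⟩, ⟨px3, py3⟩, h1, h2, h3, d12, d23, d31, r1, r2, r3⟩ := T
  have par : ∀ x y : ℝ, onEllipse a b (x, y) → ∃ X Y : ℝ, x = a*X ∧ y = b*Y ∧ X^2+Y^2=1 := by
    intro x y hxy
    refine ⟨x/a, y/b, by field_simp, by field_simp, ?_⟩
    rw [div_pow, div_pow]; exact hxy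
  obtain ⟨X1, Y1, rfl, rfl, e1⟩ := par _ _ h1
  obtain ⟨X2, Y2, rfl, rfl, e2⟩ := par _ _ h2
  obtain ⟨X3, Y3, rfl, rfl, e3⟩ := par _ _ h3
  have D12 : ¬ (X1 = X2 ∧ Y1 = Y2) := fun h => d12 (by rw [h.1, h.2])
  have D23 : ¬ (X2 = X3 ∧ Y2 = Y3) := fun h => d23 (by rw [h.1, h.2])
  have D31 : ¬ (X3 = X1 ∧ Y3 = Y1) := fun h => d31 (by rw [h.1, h.2])
  have s1 := reflectEq a b X1 Y1 X3 Y3 X2 Y2 ha hb e1 e3 e2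
    (fun h => D31 ⟨h.1.symm, h.2.symm⟩) D12 r1
  have s2 := reflectEq a b X2 Y2 X1 Y1 X3 Y3 ha hb e2 e1 e3
    (fun h => D12 ⟨h.1.symm, h.2.symm⟩) D23 r2
  have g12 := gPos X1 Y1 X2 Y2 e1 e2 D12
  have m12 := mPos a b X1 Y1 X2 Y2 ha hb e1 e2 D12
  obtain ⟨J, hJ⟩ : ∃ J : ℝ, J = (1-X1*X2-Y1*Y2)/(a^2+b^2-(a^2-b^2)*(X1*X2-Y1*Y2)) := ⟨_, rfl⟩
  have J0 : 0 < J := by rw [hJ]; positivity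
  have J12 : 1-X1*X2-Y1*Y2 = J*(a^2+b^2-(a^2-b^2)*(X1*X2-Y1*Y2)) := by
    rw [hJ, div_mul_cancel₀ _ m12.ne']
  have J31 : 1-X3*X1-Y3*Y1 = J*(a^2+b^2-(a^2-b^2)*(X3*X1-Y3*Y1)) := by
    apply mul_right_cancel₀ m12.ne'
    linear_combination s1 + (a^2+b^2-(a^2-b^2)*(X3*X1-Y3*Y1))*J12
  have J23 : 1-X2*X3-Y2*Y3 = J*(a^2+b^2-(a^2-b^2)*(X2*X3-Y2*Y3)) := by
    apply mul_right_cancel₀ m12.ne'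
    linear_combination -s2 + (a^2+b^2-(a^2-b^2)*(X2*X3-Y2*Y3))*J12
  have R12 : (1-J*c^2)*(X1*X2)+(1+J*c^2)*(Y1*Y2) = 1-J*(a^2+b^2) := by
    rw [hc2]; linear_combination -J12
  have R23 : (1-J*c^2)*(X2*X3)+(1+J*c^2)*(Y2*Y3) = 1-J*(a^2+b^2) := by
    rw [hc2]; linear_combination -J23
  have R31 : (1-J*c^2)*(X3*X1)+(1+J*c^2)*(Y3*Y1) = 1-J*(a^2+b^2) := by
    rw [hc2]; linear_combination -J31
  have hg := closureR X1 X2 X3 Y1 Y2 Y3 (J*c^2) (1-J*(a^2+b^2)) e1 e2 e3 D12 D23 D31 R12 R23 R31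
  obtain ⟨e, he⟩ : ∃ e : ℝ, c = a*e := ⟨c/a, by field_simp⟩
  obtain ⟨bb, hbb⟩ : ∃ bb : ℝ, b = a*bb := ⟨b/a, by field_simp⟩
  have e0 : 0 < e := by rw [he] at hc0; exact (mul_pos_iff_of_pos_left ha).1 hc0
  have bb0 : 0 < bb := by rw [hbb] at hb; exact (mul_pos_iff_of_pos_left ha).1 hb
  have hbe : bb^2 = 1-e^2 := by
    rw [he, hbb] at hc2
    apply mul_left_cancel₀ (pow_pos ha 2).ne'
    linear_combination hc2
  have e1' : e < 1 := ltOne e (by rw [← hbe]; positivity)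
  have heq : e^2*((3-J*c^2)*(1+J*c^2)) = 4*(J*c^2) := by
    have ab : a^2+b^2 = a^2*(2-e^2) := by rw [hbb]; linear_combination a^2*hbe
    rw [ab] at hg
    have cc : c^2 = a^2*e^2 := by rw [he]; ring
    rw [cc] at hg ⊢
    linear_combination e^2*hg
  have hk : 0 < ρ^2*a/b^2 := by positivity
  obtain ⟨h, heh, hhe, fin⟩ := mid (-c) (ρ^2*a/b^2) e (J*c^2) (1-J*(a^2+b^2)) bb X1 Y1 X2 Y2 X3 Y3
    hk e0 e1' (by positivity) bb0 hbe e1 e2 e3 D12 D23 D31 R12 R23 R31 hg heq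
  have hδ : δ = a^2*(1+e^2-e*h) := by
    have : a^4-a^2*b^2+b^4 = (a^2*(1+e^2-e*h))^2 := by
      have : a^4-a^2*b^2+b^4 = a^4*(1-bb^2+(bb^2)^2) := by rw [hbb]; ring
      rw [this, hbe]
      linear_combination -a^4*e*hhe
    change Real.sqrt (a^4-a^2*b^2+b^4) = _
    rw [this]
    apply Real.sqrt_sq
    have : 0 < 1+e^2-e*h := by have := sq_nonneg e; linarith
    positivity
  have rad : -a^2+b^2+δ = a^2*(1-e*h) := by
    rw [hδ, hbb]; linear_combination a^2*hbe
  have iv : ∀ X Y : ℝ, X^2+Y^2=1 → inva ρ f1 (a*X, b*Y) =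
      (-c + ρ^2*a/b^2*(1-e^2)*((X+e)/(1+e*X)^2), ρ^2*a/b^2*(1-e^2)*(bb*Y/(1+e*X)^2)) := by
    intro X Y hXY
    have hp : 0 < 1+e*X :=  dPos e X Y e0 e1' hXY
    have hd : (a*X - -c)^2+(b*Y-0)^2 = a^2*(1+e*X)^2 := by
      rw [he, hbb]; linear_combination a^2*(1-e^2)*hXY + a^2*Y^2*hbe
    have hk' : ρ^2*a/b^2*(1-e^2) = ρ^2/a := by
      rw [← hbe, hbb]; field_simp
    unfold inva
    apply Prod.ext
    · simp only [f1, Prod.fst_add, Prod.smul_fst, Prod.fst_sub, smul_eq_mul]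
      rw [hd, hk', he]; field_simp; ring
    · simp only [f1, Prod.snd_add, Prod.smul_snd, Prod.snd_sub, smul_eq_mul]
      rw [hd, hk', hbb]; field_simp; ring
  have hC : Ctr = (-c + ρ^2*a/b^2*(e*((1-e*h)/2)), 0) := by
    simp only [Ctr]
    rw [rad, he]
    congr 1
    field_simp
  simp only
  rw [iv X1 Y1 e1, iv X2 Y2 e2, iv X3 Y3 e3, hC, fin, rad]
  field_simp
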